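/- arXiv:0802.1414 — 5 statements merged into one kernel-verified Lean document; each statement's English description precedes it below -/
import Mathlib

section
/- For every h>0, t>0 and r≥0 one has the two-sided estimate exp(−ht − h·r²/4) · (1/(4πt))·exp(−r²/(4t)) ≤ (h/(4π·sinh(ht)))·exp(−h·r²·coth(ht)/4) ≤ (1/(4πt))·exp(−r²/(4t)). (Equivalently, the modulus |P_h(x,y;t)| of the Landau heat kernel satisfies exp(−ht − h|x−y|²/4)·P_0(x,y;t) ≤ |P_h(x,y;t)| ≤ P_0(x,y;t), where P_0 is the free heat kernel.) -/
open MeasureTheory Real Set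

/-- Modulus of the Landau heat kernel at distance `r`:
`p_h(r,t) = (h/(4π sinh(ht))) exp(−h r² coth(ht)/4)`. -/
noncomputable def landauHeatKernel (h r t : ℝ) : ℝ :=
  h / (4 * π * Real.sinh (h * t)) *
    Real.exp (-(h * r ^ 2 * (Real.cosh (h * t) / Real.sinh (h * t))) / 4)

/-- Free heat kernel on `ℝ²` at distance `r`: `p_0(r,t) = (1/(4πt)) exp(−r²/(4t))`. -/
noncomputable def freeHeatKernel (r t : ℝ) : ℝ :=
  1 / (4 * π * t) * Real.exp (-(r ^ 2) / (4 * t))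

theorem sinh_le_mul_cosh {a : ℝ} (ha : 0 ≤ a) : Real.sinh a ≤ a * Real.cosh a := by
  have hd (x : ℝ) :
      HasDerivAt (fun y => y * Real.cosh y - Real.sinh y) (x * Real.sinh x) x := by
    exact (((hasDerivAt_id' x).mul (Real.hasDerivAt_cosh x)).sub
      (Real.hasDerivAt_sinh x)).congr_deriv (by ring)
  have hmono : MonotoneOn (fun y => y * Real.cosh y - Real.sinh y) (Ici 0) := by
    refine monotoneOn_of_deriv_nonneg (convex_Ici 0)
      (fun x _ => (hd x).continuousAt.continuousWithinAt)
      (fun x _ => (hd x).differentiableAt.differentiableWithinAt) fun x hx => ?_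
    rw [interior_Ici] at hx
    rw [(hd x).deriv]
    exact mul_nonneg (le_of_lt hx) (Real.sinh_nonneg_iff.2 (le_of_lt hx))
  simpa using hmono self_mem_Ici ha ha

theorem sinh_le_mul_exp {a : ℝ} (ha : 0 ≤ a) : Real.sinh a ≤ a * Real.exp a := by
  refine (sinh_le_mul_cosh ha).trans (mul_le_mul_of_nonneg_left ?_ ha)
  linarith [Real.cosh_add_sinh a, Real.sinh_nonneg_iff.2 ha]

theorem mul_cosh_le_add_one_mul_sinh {a : ℝ} (ha : 0 ≤ a) :
    a * Real.cosh a ≤ (a + 1) * Real.sinh a := by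
  have h_exp : Real.exp (-a) ≤ 1 := Real.exp_le_one_iff.2 (by linarith)
  nlinarith [Real.cosh_sub_sinh a, Real.self_le_sinh_iff.2 ha,
    mul_le_mul_of_nonneg_left h_exp ha]

/-- For every `h>0`, `t>0` and `r≥0`:
`exp(−ht − h r²/4) p_0(r,t) ≤ p_h(r,t) ≤ p_0(r,t)`. -/
theorem landau_heat_kernel_two_sided_estimate
    (h t r : ℝ) (hh : 0 < h) (ht : 0 < t) (hr : 0 ≤ r) :
    Real.exp (-(h * t) - h * r ^ 2 / 4) * freeHeatKernel r t ≤ landauHeatKernel h r t ∧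
      landauHeatKernel h r t ≤ freeHeatKernel r t := by
  have ha : 0 < h * t := mul_pos hh ht
  have hs : 0 < Real.sinh (h * t) := Real.sinh_pos_iff.2 ha
  have hq : 0 ≤ h * r ^ 2 / 4 := by positivity
  have h_free : -(r ^ 2) / (4 * t) = -(h * r ^ 2 / 4 * (1 / (h * t))) := by field_simp
  have h_landau (c : ℝ) : -(h * r ^ 2 * c) / 4 = -(h * r ^ 2 / 4 * c) := by ring
  unfold freeHeatKernel landauHeatKernel
  rw [h_free, h_landau]
  constructor
  · have h_pre : Real.exp (-(h * t)) * (1 / (4 * π * t)) ≤ h / (4 * π * Real.sinh (h * t)) := by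
      rw [Real.exp_neg, ← one_div, div_mul_div_comm, div_le_div_iff₀ (by positivity) (by positivity)]
      nlinarith [mul_le_mul_of_nonneg_left (sinh_le_mul_exp ha.le) Real.pi_pos.le]
    have h_coth : Real.cosh (h * t) / Real.sinh (h * t) ≤ 1 + 1 / (h * t) := by
      rw [one_add_div ha.ne', div_le_div_iff₀ hs ha]
      linarith [mul_cosh_le_add_one_mul_sinh ha.le]
    calc
      _ = Real.exp (-(h * t)) * (1 / (4 * π * t)) *
          Real.exp (-(h * r ^ 2 / 4 * (1 + 1 / (h * t)))) := by
        rw [mul_add, neg_add, Real.exp_add, sub_eq_add_neg, Real.exp_add, mul_one]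
        ring
      _ ≤ _ := by gcongr
  · have h_pre : h / (4 * π * Real.sinh (h * t)) ≤ 1 / (4 * π * t) := by
      rw [div_le_div_iff₀ (by positivity) (by positivity)]
      nlinarith [mul_le_mul_of_nonneg_left (Real.self_le_sinh_iff.2 ha.le) Real.pi_pos.le]
    have h_coth : 1 / (h * t) ≤ Real.cosh (h * t) / Real.sinh (h * t) := by
      rw [div_le_div_iff₀ ha hs]
      linarith [sinh_le_mul_cosh ha.le]
    gcongr
end

section
/- For every h>0, every r≥0 and every real z with z<h one has ∫₀^∞ t·e^{zt} p_h(r,t) dt ≥ exp(−h·r²/4) · ∫₀^∞ t·e^{(z−h)t} p_0(r,t) dt (both integrals converging absolutely). In terms of kernels this says |G_h^{(2)}(x,y;z)| ≥ G_0^{(2)}(x,y;z−h)·exp(−h|x−y|²/4), where G^{(2)} denotes the integral kernel of the squared resolvent. -/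
open MeasureTheory Real Set

/-- `sinh s ≤ s eˢ`. -/
lemma sinh_le_mul_exp_s2 (s : ℝ) : sinh s ≤ s * exp s := by
  have h1 : exp (-s) = exp s * exp (-2 * s) := by rw [← exp_add]; ring_nf
  rw [sinh_eq, h1]
  nlinarith [add_one_le_exp (-2 * s), exp_pos s]

/-- `s eˢ ≤ (1 + 2s) sinh s`. -/
lemma mul_exp_le_mul_sinh (s : ℝ) : s * exp s ≤ (1 + 2 * s) * sinh s := by
  have h1 : exp s = exp (-s) * exp (2 * s) := by rw [← exp_add]; ring_nf
  rw [sinh_eq]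
  nlinarith [mul_le_mul_of_nonneg_left (add_one_le_exp (2 * s)) (exp_pos (-s)).le]

/-- `coth s ≤ 1 + 1 / s` for `s > 0`. -/
lemma cosh_div_sinh_le {s : ℝ} (hs : 0 < s) : cosh s / sinh s ≤ 1 + 1 / s := by
  have hsinh : 0 < sinh s := sinh_pos_iff.2 hs
  have h1 : s ≤ sinh s := self_le_sinh_iff.2 hs.le
  have h2 : cosh s - sinh s ≤ 1 := by
    rw [cosh_sub_sinh]
    exact exp_le_one_iff.2 (by linarith)
  rw [div_le_iff₀ hsinh]
  have h3 : 1 ≤ 1 / s * sinh s := by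
    rw [one_div_mul_eq_div, le_div_iff₀ hs]
    linarith
  linarith

/-- Pointwise comparison of the Landau and the free heat kernels. -/
lemma freeHeatKernel_le_landauHeatKernel {h t : ℝ} (r : ℝ) (hh : 0 < h) (ht : 0 < t) :
    exp (-(h * r ^ 2) / 4) * (exp (-(h * t)) * freeHeatKernel r t) ≤ landauHeatKernel h r t := by
  have hs : 0 < h * t := mul_pos hh ht
  have hsinh : 0 < sinh (h * t) := sinh_pos_iff.2 hs
  have hpre : exp (-(h * t)) * (1 / (4 * π * t)) ≤ h / (4 * π * sinh (h * t)) := by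
    rw [exp_neg, inv_mul_eq_div, div_div, div_le_div_iff₀ (by positivity) (by positivity)]
    nlinarith [mul_le_mul_of_nonneg_left (sinh_le_mul_exp_s2 (h * t)) pi_pos.le]
  have hexp : -(h * r ^ 2) / 4 + -(r ^ 2) / (4 * t) ≤
      -(h * r ^ 2 * (cosh (h * t) / sinh (h * t))) / 4 := by
    have h1 := mul_le_mul_of_nonneg_left (cosh_div_sinh_le hs)
      (mul_nonneg hh.le (sq_nonneg r))
    have h2 : h * r ^ 2 * (1 + 1 / (h * t)) = h * r ^ 2 + 4 * (r ^ 2 / (4 * t)) := by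
      field_simp
    rw [neg_div (4 * t)]
    linarith
  calc exp (-(h * r ^ 2) / 4) * (exp (-(h * t)) * freeHeatKernel r t)
      = exp (-(h * t)) * (1 / (4 * π * t)) *
          exp (-(h * r ^ 2) / 4 + -(r ^ 2) / (4 * t)) := by
        rw [freeHeatKernel, exp_add]; ring
    _ ≤ landauHeatKernel h r t := by
        rw [landauHeatKernel]
        gcongr

lemma freeHeatKernel_nonneg {t : ℝ} (r : ℝ) (ht : 0 < t) : 0 ≤ freeHeatKernel r t := by
  rw [freeHeatKernel]
  positivity

lemma mul_freeHeatKernel_le {t : ℝ} (r : ℝ) (ht : 0 < t) :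
    t * freeHeatKernel r t ≤ 1 / (4 * π) := by
  have h1 : exp (-(r ^ 2) / (4 * t)) ≤ 1 :=
    exp_le_one_iff.2 (div_nonpos_of_nonpos_of_nonneg (by nlinarith [sq_nonneg r]) (by positivity))
  calc t * freeHeatKernel r t = 1 / (4 * π) * exp (-(r ^ 2) / (4 * t)) := by
        rw [freeHeatKernel]; field_simp
    _ ≤ 1 / (4 * π) * 1 := by gcongr
    _ = 1 / (4 * π) := mul_one _

lemma landauHeatKernel_nonneg {h t : ℝ} (r : ℝ) (hh : 0 < h) (ht : 0 < t) :
    0 ≤ landauHeatKernel h r t := by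
  have hsinh : 0 < sinh (h * t) := sinh_pos_iff.2 (mul_pos hh ht)
  rw [landauHeatKernel]
  positivity

lemma mul_landauHeatKernel_le {h t : ℝ} (r : ℝ) (hh : 0 < h) (ht : 0 < t) :
    t * landauHeatKernel h r t ≤ 1 / (4 * π) * ((1 + 2 * (h * t)) * exp (-(h * t))) := by
  have hs : 0 < h * t := mul_pos hh ht
  have hsinh : 0 < sinh (h * t) := sinh_pos_iff.2 hs
  have hcosh : 0 < cosh (h * t) := cosh_pos _
  have h1 : exp (-(h * r ^ 2 * (cosh (h * t) / sinh (h * t))) / 4) ≤ 1 := by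
    refine exp_le_one_iff.2 (div_nonpos_of_nonpos_of_nonneg (neg_nonpos.2 ?_) (by norm_num))
    positivity
  have h2 : h * t / sinh (h * t) ≤ (1 + 2 * (h * t)) * exp (-(h * t)) := by
    rw [exp_neg, ← div_eq_mul_inv, div_le_div_iff₀ hsinh (exp_pos _)]
    exact mul_exp_le_mul_sinh _
  calc t * landauHeatKernel h r t
      = 1 / (4 * π) * (h * t / sinh (h * t) *
          exp (-(h * r ^ 2 * (cosh (h * t) / sinh (h * t))) / 4)) := by
        rw [landauHeatKernel]; field_simp
    _ ≤ 1 / (4 * π) * (h * t / sinh (h * t) * 1) := by gcongr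
    _ ≤ 1 / (4 * π) * ((1 + 2 * (h * t)) * exp (-(h * t))) := by
        rw [mul_one]
        gcongr

lemma integrableOn_mul_exp_mul_freeHeatKernel {a : ℝ} (r : ℝ) (ha : a < 0) :
    IntegrableOn (fun t : ℝ => t * exp (a * t) * freeHeatKernel r t) (Ioi 0) := by
  refine Integrable.mono' ((integrableOn_exp_mul_Ioi ha 0).const_mul (1 / (4 * π)))
    (Measurable.aestronglyMeasurable (by unfold freeHeatKernel; fun_prop)) ?_
  filter_upwards [ae_restrict_mem measurableSet_Ioi] with t ht
  have ht : 0 < t := ht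
  have h0 := freeHeatKernel_nonneg r ht
  rw [norm_of_nonneg (by positivity), mul_right_comm]
  exact mul_le_mul_of_nonneg_right (mul_freeHeatKernel_le r ht) (exp_pos _).le

lemma integrableOn_mul_exp_mul_landauHeatKernel {h z : ℝ} (r : ℝ) (hh : 0 < h) (hz : z < h) :
    IntegrableOn (fun t : ℝ => t * exp (z * t) * landauHeatKernel h r t) (Ioi 0) := by
  have hexp : IntegrableOn (fun t : ℝ => exp ((z - h) * t)) (Ioi 0) :=
    integrableOn_exp_mul_Ioi (sub_neg.2 hz) 0
  have hmul : IntegrableOn (fun t : ℝ => t * exp ((z - h) * t)) (Ioi 0) := by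
    simpa [← neg_mul] using integrableOn_rpow_mul_exp_neg_mul_rpow (s := 1) (p := 1)
      (by norm_num) (by norm_num) (sub_pos.2 hz)
  refine Integrable.mono' ((hexp.add (hmul.const_mul (2 * h))).const_mul (1 / (4 * π)))
    (Measurable.aestronglyMeasurable (by unfold landauHeatKernel; fun_prop)) ?_
  filter_upwards [ae_restrict_mem measurableSet_Ioi] with t ht
  have ht : 0 < t := ht
  have h0 := landauHeatKernel_nonneg r hh ht
  have hsplit : exp ((z - h) * t) = exp (-(h * t)) * exp (z * t) := by
    rw [← exp_add]; ring_nf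
  rw [norm_of_nonneg (by positivity), mul_right_comm]
  refine (mul_le_mul_of_nonneg_right (mul_landauHeatKernel_le r hh ht) (exp_pos _).le).trans_eq ?_
  simp only [Pi.add_apply, hsplit]
  ring

/-- For `h>0`, `r≥0` and real `z<h`:
`∫₀^∞ t e^{zt} p_h(r,t) dt ≥ exp(−h r²/4) ∫₀^∞ t e^{(z−h)t} p_0(r,t) dt`,
both integrals converging absolutely.  In kernel terms:
`|G_h^{(2)}(x,y;z)| ≥ G_0^{(2)}(x,y;z−h) exp(−h|x−y|²/4)`. -/
theorem landau_squared_resolvent_lower_bound (h r z : ℝ) (hh : 0 < h) (hr : 0 ≤ r) (hz : z < h) :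
    IntegrableOn (fun t : ℝ => t * Real.exp (z * t) * landauHeatKernel h r t) (Ioi 0) ∧
    IntegrableOn (fun t : ℝ => t * Real.exp ((z - h) * t) * freeHeatKernel r t) (Ioi 0) ∧
    Real.exp (-(h * r ^ 2) / 4) *
        ∫ t in Ioi (0 : ℝ), t * Real.exp ((z - h) * t) * freeHeatKernel r t ≤
      ∫ t in Ioi (0 : ℝ), t * Real.exp (z * t) * landauHeatKernel h r t := by
  refine ⟨integrableOn_mul_exp_mul_landauHeatKernel r hh hz,
    integrableOn_mul_exp_mul_freeHeatKernel r (sub_neg.2 hz), ?_⟩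
  rw [← integral_const_mul]
  refine setIntegral_mono_on
    ((integrableOn_mul_exp_mul_freeHeatKernel r (sub_neg.2 hz)).const_mul _)
    (integrableOn_mul_exp_mul_landauHeatKernel r hh hz) measurableSet_Ioi fun t ht => ?_
  have ht : 0 < t := ht
  have hsplit : exp ((z - h) * t) = exp (z * t) * exp (-(h * t)) := by
    rw [← exp_add]; ring_nf
  calc exp (-(h * r ^ 2) / 4) * (t * exp ((z - h) * t) * freeHeatKernel r t)
      = t * exp (z * t) *
          (exp (-(h * r ^ 2) / 4) * (exp (-(h * t)) * freeHeatKernel r t)) := by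
        rw [hsplit]; ring
    _ ≤ t * exp (z * t) * landauHeatKernel h r t :=
        mul_le_mul_of_nonneg_left (freeHeatKernel_le_landauHeatKernel r hh ht) (by positivity)
end

section
/- For every h>0 and every z∈ℂ with Re z<0, the integral ∫₀^∞ e^{zt}·(1/(4π))·(h/sinh(ht) − 1/t) dt converges absolutely and satisfies |∫₀^∞ e^{zt}·(1/(4π))·(h/sinh(ht) − 1/t) dt| ≤ (1/(4π))·log((h − Re z)/(−Re z)). (This integral equals q(z,h) − q_0(z), the difference between the regularized diagonal values of the Green functions of the Landau Hamiltonian and of the free Laplacian.) -/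
open MeasureTheory Real Set

/-- Difference of the on-diagonal heat kernels of the Landau Hamiltonian and of the free
Laplacian on `ℝ²`: `(1/(4π))(h/sinh(ht) − 1/t)`. -/
noncomputable def diagHeatDiff (h t : ℝ) : ℝ :=
  (1 / (4 * π)) * (h / Real.sinh (h * t) - 1 / t)

/-- The heat kernel difference is dominated by the Frullani integrand of the exponential. -/
theorem abs_diagHeatDiff_le {h t : ℝ} (hh : 0 < h) (ht : 0 < t) :
    |diagHeatDiff h t| ≤ (1 / (4 * π)) * (t⁻¹ * (1 - Real.exp (-(h * t)))) := by
  have hx : 0 < h * t := mul_pos hh ht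
  have hs : h * t < Real.sinh (h * t) := Real.self_lt_sinh_iff.2 hx
  have hs0 : 0 < Real.sinh (h * t) := hx.trans hs
  have hupper : Real.exp (-(h * t)) * Real.sinh (h * t) ≤ h * t := by
    have h1 : Real.exp (-(h * t)) * Real.exp (h * t) = 1 := by
      rw [← Real.exp_add]; simp
    have h2 : Real.exp (-(h * t)) * Real.exp (-(h * t)) = Real.exp (-(2 * (h * t))) := by
      rw [← Real.exp_add]; ring_nf
    have h3 := Real.add_one_le_exp (-(2 * (h * t)))
    rw [Real.sinh_eq]
    linarith
  have heq : h / Real.sinh (h * t) = t⁻¹ * (h * t / Real.sinh (h * t)) := by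
    field_simp
  have hle : h * t / Real.sinh (h * t) ≤ 1 := (div_le_one hs0).2 hs.le
  have hge : Real.exp (-(h * t)) ≤ h * t / Real.sinh (h * t) := (le_div_iff₀ hs0).2 hupper
  have hrw : h / Real.sinh (h * t) - 1 / t = -(t⁻¹ * (1 - h * t / Real.sinh (h * t))) := by
    rw [heq]; ring
  rw [diagHeatDiff, hrw, abs_mul, abs_neg, abs_of_pos (by positivity : 0 < 1 / (4 * π)),
    abs_of_nonneg (mul_nonneg (inv_nonneg.2 ht.le) (sub_nonneg.2 hle))]
  gcongr

/-- The Frullani integrand of the exponential is integrable on the half line. -/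
theorem integrableOn_inv_mul_exp_neg_sub_exp_neg {a b : ℝ} (ha : 0 < a) (hab : a ≤ b) :
    IntegrableOn (fun t : ℝ => t⁻¹ * (Real.exp (-(a * t)) - Real.exp (-(b * t)))) (Ioi 0) := by
  have hdom : IntegrableOn (fun t : ℝ => (b - a) * Real.exp (-a * t)) (Ioi 0) :=
    (exp_neg_integrableOn_Ioi 0 ha).const_mul (b - a)
  refine Integrable.mono' hdom (by fun_prop) ?_
  filter_upwards [ae_restrict_mem measurableSet_Ioi] with t ht
  have ht : 0 < t := ht
  have hfac : Real.exp (-(b * t)) = Real.exp (-(a * t)) * Real.exp (-((b - a) * t)) := by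
    rw [← Real.exp_add]; ring_nf
  have hmono : Real.exp (-(b * t)) ≤ Real.exp (-(a * t)) := by gcongr
  have hexp := Real.add_one_le_exp (-((b - a) * t))
  rw [Real.norm_of_nonneg (mul_nonneg (inv_nonneg.2 ht.le) (sub_nonneg.2 hmono)),
    inv_mul_le_iff₀ ht, hfac, neg_mul]
  nlinarith [Real.exp_pos (-(a * t))]

/-- Frullani's integral for the exponential. -/
theorem integral_inv_mul_exp_neg_sub_exp_neg {a b : ℝ} (ha : 0 < a) (hab : a ≤ b) :
    ∫ t in Ioi (0 : ℝ), t⁻¹ * (Real.exp (-(a * t)) - Real.exp (-(b * t))) = Real.log (b / a) := by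
  have hcont : Continuous fun x : ℝ => Real.exp (-x) := by fun_prop
  have hzero : Filter.Tendsto (fun x : ℝ => Real.exp (-x)) (nhdsWithin 0 (Ioi 0)) (nhds 1) := by
    simpa using (hcont.tendsto 0).mono_left nhdsWithin_le_nhds
  simpa using Frullani.integral_Ioi_eq (f := fun x : ℝ => Real.exp (-x))
    (hcont.locallyIntegrable.locallyIntegrableOn _) ha (ha.trans_le hab) hzero
    Real.tendsto_exp_neg_atTop_nhds_zero (integrableOn_inv_mul_exp_neg_sub_exp_neg ha hab)

/-- For `h>0` and `Re z<0` the Laplace transform of the on-diagonal heat kernel difference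
converges absolutely and satisfies
`|∫₀^∞ e^{zt} (1/(4π))(h/sinh(ht) − 1/t) dt| ≤ (1/(4π)) log((h−Re z)/(−Re z))`.
This integral equals `q(z,h) − q_0(z)`. -/
theorem diag_green_difference_bound (h : ℝ) (z : ℂ) (hh : 0 < h) (hz : z.re < 0) :
    IntegrableOn (fun t : ℝ => Complex.exp (z * t) * ((diagHeatDiff h t : ℝ) : ℂ)) (Ioi 0) ∧
    ‖∫ t in Ioi (0 : ℝ), Complex.exp (z * t) * ((diagHeatDiff h t : ℝ) : ℂ)‖ ≤
      (1 / (4 * π)) * Real.log ((h - z.re) / (-z.re)) := by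
  have ha : 0 < -z.re := neg_pos.2 hz
  have hab : -z.re ≤ h - z.re := by linarith
  have hdom := (integrableOn_inv_mul_exp_neg_sub_exp_neg ha hab).const_mul (1 / (4 * π))
  have hbound : ∀ᵐ t : ℝ ∂volume.restrict (Ioi (0 : ℝ)),
      ‖Complex.exp (z * t) * ((diagHeatDiff h t : ℝ) : ℂ)‖ ≤
        (1 / (4 * π)) * (t⁻¹ * (Real.exp (-(-z.re * t)) - Real.exp (-((h - z.re) * t)))) := by
    filter_upwards [ae_restrict_mem measurableSet_Ioi] with t ht
    have hfac : Real.exp (-((h - z.re) * t)) = Real.exp (z.re * t) * Real.exp (-(h * t)) := by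
      rw [← Real.exp_add]; ring_nf
    rw [norm_mul, Complex.norm_exp, Complex.re_mul_ofReal, Complex.norm_real, Real.norm_eq_abs,
      hfac, neg_mul, neg_neg]
    calc Real.exp (z.re * t) * |diagHeatDiff h t|
        ≤ Real.exp (z.re * t) * ((1 / (4 * π)) * (t⁻¹ * (1 - Real.exp (-(h * t))))) := by
          gcongr
          exact abs_diagHeatDiff_le hh ht
      _ = _ := by ring
  have hmeas : Measurable fun t : ℝ => Complex.exp (z * t) * ((diagHeatDiff h t : ℝ) : ℂ) := by
    unfold diagHeatDiff
    fun_prop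
  refine ⟨Integrable.mono' hdom hmeas.aestronglyMeasurable hbound, ?_⟩
  rw [← integral_inv_mul_exp_neg_sub_exp_neg ha hab, ← integral_const_mul]
  exact norm_integral_le_of_norm_le hdom hbound
end

section
/- For every h>0 and every z∈ℂ with Re z<0, the integral ∫₀^∞ t·e^{zt}·(1/(4π))·(h/sinh(ht) − 1/t) dt converges absolutely and satisfies |∫₀^∞ t·e^{zt}·(1/(4π))·(h/sinh(ht) − 1/t) dt| ≤ h/(4π·(−Re z)·(h − Re z)). (This integral equals ∂q(z,h)/∂z − ∂q_0(z)/∂z for the regularized diagonal Green functions.) -/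
open MeasureTheory Real Set

/-- The difference of heat kernels satisfies
`t |diagHeatDiff h t| ≤ (1/(4π))(1 − e^{−ht})`. -/
lemma mul_abs_diagHeatDiff_le {h t : ℝ} (hh : 0 < h) (ht : 0 < t) :
    t * |diagHeatDiff h t| ≤ 1 / (4 * π) * (1 - Real.exp (-(h * t))) := by
  have hx : 0 < h * t := mul_pos hh ht
  have hs : 0 < Real.sinh (h * t) := Real.sinh_pos_iff.2 hx
  have hle : h * t / Real.sinh (h * t) ≤ 1 :=
    (div_le_one hs).2 (Real.self_le_sinh_iff.2 hx.le)
  have hge : Real.exp (-(h * t)) ≤ h * t / Real.sinh (h * t) := by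
    rw [le_div_iff₀ hs, Real.sinh_eq]
    have h1 := Real.add_one_le_exp (-(2 * (h * t)))
    have h2 : Real.exp (-(h * t)) * Real.exp (h * t) = 1 := by
      rw [← Real.exp_add]; simp
    have h3 : Real.exp (-(h * t)) * Real.exp (-(h * t)) = Real.exp (-(2 * (h * t))) := by
      rw [← Real.exp_add]; ring_nf
    linarith
  have heq : t * |diagHeatDiff h t| = 1 / (4 * π) * (1 - h * t / Real.sinh (h * t)) := by
    have hmul : t * diagHeatDiff h t = -(1 / (4 * π) * (1 - h * t / Real.sinh (h * t))) := by
      unfold diagHeatDiff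
      field_simp
      ring
    have hnonneg : 0 ≤ 1 / (4 * π) * (1 - h * t / Real.sinh (h * t)) :=
      mul_nonneg (by positivity) (by linarith)
    calc t * |diagHeatDiff h t| = |t * diagHeatDiff h t| := by rw [abs_mul, abs_of_pos ht]
      _ = _ := by rw [hmul, abs_neg, abs_of_nonneg hnonneg]
  rw [heq]
  gcongr

/-- For `h>0` and `Re z<0`:
`|∫₀^∞ t e^{zt} (1/(4π))(h/sinh(ht) − 1/t) dt| ≤ h/(4π(−Re z)(h−Re z))`,
the integral converging absolutely.  This integral equals
`∂q(z,h)/∂z − ∂q_0(z)/∂z`. -/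
theorem diag_green_difference_derivative_bound (h : ℝ) (z : ℂ) (hh : 0 < h) (hz : z.re < 0) :
    IntegrableOn
      (fun t : ℝ => (t : ℂ) * Complex.exp (z * t) * ((diagHeatDiff h t : ℝ) : ℂ)) (Ioi 0) ∧
    ‖∫ t in Ioi (0 : ℝ), (t : ℂ) * Complex.exp (z * t) * ((diagHeatDiff h t : ℝ) : ℂ)‖ ≤
      h / (4 * π * (-z.re) * (h - z.re)) := by
  have hb : z.re - h < 0 := by linarith
  have hg : IntegrableOn
      (fun t : ℝ => 1 / (4 * π) * (Real.exp (z.re * t) - Real.exp ((z.re - h) * t))) (Ioi 0) :=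
    ((integrableOn_exp_mul_Ioi hz 0).sub (integrableOn_exp_mul_Ioi hb 0)).const_mul _
  have hbound : ∀ᵐ t : ℝ ∂(volume.restrict (Ioi (0 : ℝ))),
      ‖(t : ℂ) * Complex.exp (z * t) * ((diagHeatDiff h t : ℝ) : ℂ)‖ ≤
        1 / (4 * π) * (Real.exp (z.re * t) - Real.exp ((z.re - h) * t)) := by
    filter_upwards [ae_restrict_mem measurableSet_Ioi] with t ht
    have ht : 0 < t := ht
    calc ‖(t : ℂ) * Complex.exp (z * t) * ((diagHeatDiff h t : ℝ) : ℂ)‖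
        = Real.exp (z.re * t) * (t * |diagHeatDiff h t|) := by
          rw [norm_mul, norm_mul, Complex.norm_exp, Complex.norm_real, Complex.norm_real,
            Complex.re_mul_ofReal, Real.norm_eq_abs, Real.norm_eq_abs, abs_of_pos ht]
          ring
      _ ≤ Real.exp (z.re * t) * (1 / (4 * π) * (1 - Real.exp (-(h * t)))) := by
          exact mul_le_mul_of_nonneg_left (mul_abs_diagHeatDiff_le hh ht) (Real.exp_nonneg _)
      _ = _ := by
          rw [show (z.re - h) * t = z.re * t + -(h * t) by ring, Real.exp_add]
          ring
  have hmeas : Measurable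
      (fun t : ℝ => (t : ℂ) * Complex.exp (z * t) * ((diagHeatDiff h t : ℝ) : ℂ)) := by
    unfold diagHeatDiff
    fun_prop
  refine ⟨hg.mono' hmeas.aestronglyMeasurable hbound,
    (norm_integral_le_of_norm_le hg hbound).trans_eq ?_⟩
  rw [integral_const_mul, integral_sub (integrableOn_exp_mul_Ioi hz 0)
    (integrableOn_exp_mul_Ioi hb 0), integral_exp_mul_Ioi hz, integral_exp_mul_Ioi hb]
  have h1 : z.re ≠ 0 := hz.ne
  have h2 : z.re - h ≠ 0 := hb.ne
  have h3 : h - z.re ≠ 0 := sub_ne_zero.2 (hz.trans hh).ne'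
  simp only [mul_zero, Real.exp_zero]
  field_simp
  ring
end

section
/- Let h>0 and let c:ℤ²→ℂ satisfy |c(q)| ≤ a·e^{−b|q|} for some a,b>0. Let C_h be the bounded operator on ℓ²(ℤ²;ℂ) given by (C_h f)(p) = Σ_{q∈ℤ²} e^{ih·p₂·q₁}·c(q)·f(p+q). For θ∈ℝ and n∈ℤ set b_n(θ) := Σ_{k∈ℤ} c(k,n)e^{ikθ}, and let C_h(θ) be the bounded operator on ℓ²(ℤ;ℂ) given by (C_h(θ)g)(m) = Σ_{n∈ℤ} b_n(mh+θ)·g(m+n). Then the spectrum of C_h equals the union over θ∈[0,2π) of the spectra of C_h(θ). -/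
open MeasureTheory Real Set

/-- `ℓ²(ℤ²;ℂ)`. -/
noncomputable abbrev l2Z2 : Type := lp (fun _ : ℤ × ℤ => ℂ) 2

/-- `ℓ²(ℤ;ℂ)`. -/
noncomputable abbrev l2Z : Type := lp (fun _ : ℤ => ℂ) 2

noncomputable section

theorem lp.norm_sq_eq_tsum {ι : Type*} {G : ι → Type*} [∀ i, NormedAddCommGroup (G i)]
    (f : lp G 2) : ‖f‖ ^ 2 = ∑' i, ‖f i‖ ^ 2 := by
  simpa using lp.norm_rpow_eq_tsum (p := 2) (by simp) f

theorem lp.summable_norm_sq {ι : Type*} {G : ι → Type*} [∀ i, NormedAddCommGroup (G i)]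
    (f : lp G 2) : Summable fun i => ‖f i‖ ^ 2 := by
  simpa using (lp.memℓp f).summable (by simp)

theorem memℓp_two_of_summable {ι : Type*} {G : ι → Type*} [∀ i, NormedAddCommGroup (G i)]
    {f : ∀ i, G i} (hf : Summable fun i => ‖f i‖ ^ 2) : Memℓp f 2 :=
  memℓp_gen (by simpa using hf)

section WeightedShift

variable {H : Type*} [NormedAddCommGroup H] [NormedSpace ℂ H]

theorem summable_norm_sq_weightedShift {A : ℤ → H →L[ℂ] H} {C : ℝ} (hA : ∀ k, ‖A k‖ ≤ C) (j : ℤ)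
    (f : lp (fun _ : ℤ => H) 2) : Summable fun k => ‖A k (f (k + j))‖ ^ 2 := by
  have hs : Summable fun k => C ^ 2 * ‖f (k + j)‖ ^ 2 :=
    (((Equiv.addRight j).summable_iff).2 (lp.summable_norm_sq f)).mul_left _
  refine hs.of_nonneg_of_le (fun _ => by positivity) fun k => ?_
  rw [← mul_pow]
  gcongr
  exact (A k).le_of_opNorm_le (hA k) _

/-- The bounded operator `(f k)ₖ ↦ (A k (f (k + j)))ₖ` on `ℓ²(ℤ; H)`. -/
def weightedShift (A : ℤ → H →L[ℂ] H) (C : ℝ) (hA : ∀ k, ‖A k‖ ≤ C) (j : ℤ) :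
    lp (fun _ : ℤ => H) 2 →L[ℂ] lp (fun _ : ℤ => H) 2 :=
  LinearMap.mkContinuous
    { toFun := fun f =>
        ⟨fun k => A k (f (k + j)), memℓp_two_of_summable (summable_norm_sq_weightedShift hA j f)⟩
      map_add' := fun f g => by ext k; exact map_add _ _ _
      map_smul' := fun c f => by ext k; simp } C fun f => by
    have hC : 0 ≤ C := (norm_nonneg _).trans (hA 0)
    refine (pow_le_pow_iff_left₀ (norm_nonneg _) (by positivity) two_ne_zero).1 ?_
    rw [lp.norm_sq_eq_tsum, mul_pow, lp.norm_sq_eq_tsum f, ← tsum_mul_left,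
      ← (Equiv.addRight j).tsum_eq fun k => C ^ 2 * ‖f k‖ ^ 2]
    refine (summable_norm_sq_weightedShift hA j f).tsum_le_tsum (fun k => ?_)
      (((Equiv.addRight j).summable_iff).2 ((lp.summable_norm_sq f).mul_left _))
    rw [← mul_pow]
    gcongr
    exact (A k).le_of_opNorm_le (hA k) _

theorem norm_weightedShift_le (A : ℤ → H →L[ℂ] H) (C : ℝ) (hA : ∀ k, ‖A k‖ ≤ C) (j : ℤ) :
    ‖weightedShift A C hA j‖ ≤ C :=
  LinearMap.mkContinuous_norm_le _ ((norm_nonneg _).trans (hA 0)) _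

/-- The operator `(f k)ₖ ↦ (B (f (k + j)))ₖ` on `ℓ²(ℤ; H)`. -/
def constShift (j : ℤ) (B : H →L[ℂ] H) : lp (fun _ : ℤ => H) 2 →L[ℂ] lp (fun _ : ℤ => H) 2 :=
  weightedShift (fun _ => B) ‖B‖ (fun _ => le_rfl) j

@[simp]
theorem constShift_apply (j : ℤ) (B : H →L[ℂ] H) (f : lp (fun _ : ℤ => H) 2) (k : ℤ) :
    constShift j B f k = B (f (k + j)) := rfl

theorem norm_constShift_le (j : ℤ) (B : H →L[ℂ] H) : ‖constShift j B‖ ≤ ‖B‖ :=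
  norm_weightedShift_le _ _ _ _

theorem constShift_single (j : ℤ) (B : H →L[ℂ] H) (k : ℤ) (v : H) :
    constShift j B (lp.single 2 k v) = lp.single 2 (k - j) (B v) := by
  ext m
  by_cases hm : m = k - j
  · subst hm; simp
  · rw [constShift_apply, lp.single_apply_ne _ _ _ hm, lp.single_apply_ne _ _ _ (by lia), map_zero]

theorem constShift_zero_one : constShift 0 (1 : H →L[ℂ] H) = 1 := by
  ext f k; simp

/-- The Laurent operator `(L f) k = ∑ⱼ B j (f (k + j))` on `ℓ²(ℤ; H)`. -/
def laurentOp (B : ℤ → H →L[ℂ] H) : lp (fun _ : ℤ => H) 2 →L[ℂ] lp (fun _ : ℤ => H) 2 :=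
  ∑' j, constShift j (B j)

/-- The symbol `∑ⱼ e^{ijθ} B j` of a Laurent operator. -/
def laurentSymbol (B : ℤ → H →L[ℂ] H) (θ : ℝ) : H →L[ℂ] H :=
  ∑' j : ℤ, Complex.exp (Complex.I * j * θ) • B j

theorem norm_exp_I_mul_int_mul (j : ℤ) (θ : ℝ) : ‖Complex.exp (Complex.I * j * θ)‖ = 1 := by
  rw [show Complex.I * j * θ = ((j * θ : ℝ) : ℂ) * Complex.I by push_cast; ring]
  exact Complex.norm_exp_ofReal_mul_I _

theorem laurentSymbol_periodic (B : ℤ → H →L[ℂ] H) :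
    Function.Periodic (laurentSymbol B) (2 * π) := by
  intro θ
  refine tsum_congr fun j => ?_
  congr 1
  rw [← Complex.exp_periodic.int_mul j (Complex.I * j * θ)]
  congr 1
  push_cast
  ring

end WeightedShift

section BoundedBelow

variable {E : Type*} [NormedAddCommGroup E] [InnerProductSpace ℂ E]

theorem exists_forall_norm_ge_of_isUnit {T : E →L[ℂ] E} (hT : IsUnit T) :
    ∃ δ > 0, ∀ v, δ * ‖v‖ ≤ ‖T v‖ := by
  obtain ⟨u, rfl⟩ := hT
  refine ⟨(‖(↑u⁻¹ : E →L[ℂ] E)‖ + 1)⁻¹, by positivity, fun v => ?_⟩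
  rw [inv_mul_le_iff₀ (by positivity)]
  have h1 : (↑u⁻¹ : E →L[ℂ] E) ((u : E →L[ℂ] E) v) = v := by
    rw [← mul_apply_eq_comp, u.inv_mul]; rfl
  calc ‖v‖ = ‖(↑u⁻¹ : E →L[ℂ] E) ((u : E →L[ℂ] E) v)‖ := by rw [h1]
    _ ≤ ‖(↑u⁻¹ : E →L[ℂ] E)‖ * ‖(u : E →L[ℂ] E) v‖ := ContinuousLinearMap.le_opNorm _ _
    _ ≤ _ := by gcongr; linarith

theorem isUnit_of_forall_norm_ge [CompleteSpace E] {T : E →L[ℂ] E} {δ δ' : ℝ} (hδ : 0 < δ)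
    (hδ' : 0 < δ') (h1 : ∀ v, δ * ‖v‖ ≤ ‖T v‖) (h2 : ∀ v, δ' * ‖v‖ ≤ ‖T.adjoint v‖) : IsUnit T := by
  rw [ContinuousLinearMap.isUnit_iff_bijective,
    ContinuousLinearMap.bijective_iff_dense_range_and_antilipschitz]
  constructor
  · rw [Submodule.topologicalClosure_eq_top_iff, ContinuousLinearMap.orthogonal_range, eq_bot_iff]
    intro v hv
    have h3 := h2 v
    rw [show T.adjoint v = 0 from hv, norm_zero] at h3
    have : ‖v‖ ≤ 0 := by by_contra! h; nlinarith
    simpa using this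
  · refine ⟨δ⁻¹.toNNReal, AddMonoidHomClass.antilipschitz_of_bound T fun v => ?_⟩
    rw [Real.coe_toNNReal _ (by positivity), inv_mul_eq_div, le_div_iff₀' hδ]
    exact h1 v

end BoundedBelow

section Laurent

variable {H : Type*} [NormedAddCommGroup H] [InnerProductSpace ℂ H] [CompleteSpace H]

theorem summable_constShift {B : ℤ → H →L[ℂ] H} (hB : Summable fun j => ‖B j‖) :
    Summable fun j => constShift j (B j) :=
  .of_norm_bounded hB fun j => norm_constShift_le j (B j)

theorem norm_exp_smul_le (B : ℤ → H →L[ℂ] H) (θ : ℝ) (j : ℤ) :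
    ‖Complex.exp (Complex.I * j * θ) • B j‖ ≤ ‖B j‖ := by
  rw [norm_smul, norm_exp_I_mul_int_mul, one_mul]

theorem summable_exp_smul {B : ℤ → H →L[ℂ] H} (hB : Summable fun j => ‖B j‖) (θ : ℝ) :
    Summable fun j : ℤ => Complex.exp (Complex.I * j * θ) • B j :=
  .of_norm_bounded hB (norm_exp_smul_le B θ)

theorem laurentOp_apply {B : ℤ → H →L[ℂ] H} (hB : Summable fun j => ‖B j‖)
    (f : lp (fun _ : ℤ => H) 2) (k : ℤ) : laurentOp B f k = ∑' j, B j (f (k + j)) := by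
  have h := (summable_constShift hB).hasSum.mapL (ContinuousLinearMap.apply ℂ _ f)
  exact (h.mapL (lp.evalCLM ℂ (fun _ : ℤ => H) 2 k)).tsum_eq.symm

theorem adjoint_constShift (j : ℤ) (B : H →L[ℂ] H) :
    (constShift j B).adjoint = constShift (-j) B.adjoint := by
  symm
  rw [ContinuousLinearMap.eq_adjoint_iff]
  intro f g
  rw [lp.inner_eq_tsum, lp.inner_eq_tsum, ← (Equiv.addRight j).tsum_eq]
  refine tsum_congr fun k => ?_
  simp [ContinuousLinearMap.adjoint_inner_left]

theorem adjoint_laurentOp {B : ℤ → H →L[ℂ] H} (hB : Summable fun j => ‖B j‖) :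
    (laurentOp B).adjoint = laurentOp fun j => (B (-j)).adjoint := by
  have h := (summable_constShift hB).hasSum.mapL
    (ContinuousLinearMap.adjoint (𝕜 := ℂ) (E := lp (fun _ : ℤ => H) 2)
      (F := lp (fun _ : ℤ => H) 2)).toContinuousLinearEquiv.toContinuousLinearMap
  rw [laurentOp, laurentOp,
    ← (Equiv.neg ℤ).tsum_eq fun j => constShift j (B (-j)).adjoint]
  refine h.tsum_eq.symm.trans (tsum_congr fun j => ?_)
  simp [adjoint_constShift]

theorem adjoint_laurentSymbol {B : ℤ → H →L[ℂ] H} (hB : Summable fun j => ‖B j‖) (θ : ℝ) :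
    (laurentSymbol B θ).adjoint = laurentSymbol (fun j => (B (-j)).adjoint) θ := by
  have h := (summable_exp_smul hB θ).hasSum.mapL
    (ContinuousLinearMap.adjoint (𝕜 := ℂ) (E := H)
      (F := H)).toContinuousLinearEquiv.toContinuousLinearMap
  rw [laurentSymbol, laurentSymbol,
    ← (Equiv.neg ℤ).tsum_eq fun j : ℤ => Complex.exp (Complex.I * j * θ) • (B (-j)).adjoint]
  refine h.tsum_eq.symm.trans (tsum_congr fun j => ?_)
  simp [← Complex.exp_conj]

theorem summable_norm_adjoint_neg {B : ℤ → H →L[ℂ] H} (hB : Summable fun j => ‖B j‖) :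
    Summable fun j => ‖(B (-j)).adjoint‖ := by
  simpa [Function.comp_def] using (Equiv.neg ℤ).summable_iff.2 hB

theorem continuous_laurentSymbol {B : ℤ → H →L[ℂ] H} (hB : Summable fun j => ‖B j‖) :
    Continuous (laurentSymbol B) :=
  continuous_tsum (fun j => by fun_prop) hB fun j θ => norm_exp_smul_le B θ j

theorem exists_finset_norm_sub_le {B : ℤ → H →L[ℂ] H} (hB : Summable fun j => ‖B j‖) {ε : ℝ}
    (hε : 0 < ε) : ∃ t : Finset ℤ, ‖laurentOp B - ∑ j ∈ t, constShift j (B j)‖ ≤ ε ∧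
      ∀ θ : ℝ, ‖laurentSymbol B θ - ∑ j ∈ t, Complex.exp (Complex.I * j * θ) • B j‖ ≤ ε := by
  obtain ⟨t, ht⟩ := ((tendsto_order.1 (tendsto_tsum_compl_atTop_zero fun j => ‖B j‖)).2 ε hε).exists
  have key : ∀ {F : Type _} [NormedAddCommGroup F] [CompleteSpace F] (u : ℤ → F),
      (∀ j, ‖u j‖ ≤ ‖B j‖) → ‖∑' j, u j - ∑ j ∈ t, u j‖ ≤ ε := by
    intro F _ _ u hu
    have hu' : Summable u := .of_norm_bounded hB hu
    rw [← hu'.sum_add_tsum_compl (s := t), add_sub_cancel_left]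
    refine (tsum_of_norm_bounded (hB.subtype _).hasSum fun j => hu j).trans ht.le
  exact ⟨t, key _ fun j => norm_constShift_le j (B j), fun θ => key _ (norm_exp_smul_le B θ)⟩

theorem exists_forall_norm_laurentSymbol_ge {B : ℤ → H →L[ℂ] H} (hB : Summable fun j => ‖B j‖)
    (hu : ∀ θ ∈ Ico (0 : ℝ) (2 * π), IsUnit (laurentSymbol B θ)) :
    ∃ δ > 0, ∀ θ v, δ * ‖v‖ ≤ ‖laurentSymbol B θ v‖ := by
  have hu' : ∀ θ, IsUnit (laurentSymbol B θ) := fun θ => by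
    obtain ⟨θ', h1, h2⟩ := (laurentSymbol_periodic B).exists_mem_Ico₀ two_pi_pos θ
    exact h2 ▸ hu θ' h1
  have hc : Continuous fun θ => Ring.inverse (laurentSymbol B θ) :=
    continuous_iff_continuousAt.2 fun θ =>
      ContinuousAt.comp (f := laurentSymbol B) (NormedRing.inverse_continuousAt (hu' θ).unit)
        (continuous_laurentSymbol hB).continuousAt
  obtain ⟨M, hM⟩ := (isCompact_Icc (a := 0) (b := 2 * π)).exists_bound_of_continuousOn
    hc.continuousOn
  have hM0 : 0 ≤ M := (norm_nonneg _).trans (hM 0 ⟨le_rfl, two_pi_pos.le⟩)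
  refine ⟨(M + 1)⁻¹, by positivity, fun θ v => ?_⟩
  obtain ⟨θ', h1, h2⟩ := (laurentSymbol_periodic B).exists_mem_Ico₀ two_pi_pos θ
  rw [h2, inv_mul_le_iff₀ (by positivity)]
  have h3 : Ring.inverse (laurentSymbol B θ') (laurentSymbol B θ' v) = v := by
    rw [← mul_apply_eq_comp, Ring.inverse_mul_cancel _ (hu' θ')]; rfl
  calc ‖v‖ = ‖Ring.inverse (laurentSymbol B θ') (laurentSymbol B θ' v)‖ := by rw [h3]
    _ ≤ M * ‖laurentSymbol B θ' v‖ :=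
      ContinuousLinearMap.le_of_opNorm_le _ (hM θ' ⟨h1.1, h1.2.le⟩) _
    _ ≤ _ := by gcongr; linarith

end Laurent

section Fourier

variable {H : Type*} [NormedAddCommGroup H] [InnerProductSpace ℂ H]

theorem integral_exp_I_mul_int (j : ℤ) :
    ∫ θ in (0 : ℝ)..2 * π, Complex.exp (Complex.I * j * θ) = if j = 0 then ((2 * π : ℝ) : ℂ) else 0 := by
  split_ifs with hj
  · simp [hj]
  · have hc : Complex.I * j ≠ 0 := by simp [hj]
    rw [integral_exp_mul_complex hc]
    have : Complex.exp (Complex.I * j * ((2 * π : ℝ) : ℂ)) = 1 := by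
      rw [← Complex.exp_int_mul_two_pi_mul_I j]
      congr 1
      push_cast
      ring
    rw [this]
    simp

theorem coe_norm_sq_eq_inner_self (x : H) : (‖x‖ : ℂ) ^ 2 = inner ℂ x x :=
  (inner_self_eq_norm_sq_to_K x).symm

theorem integral_norm_sq_sum_exp_smul (s : Finset ℤ) (v : ℤ → H) :
    ∫ θ in (0 : ℝ)..2 * π, ‖∑ k ∈ s, Complex.exp (Complex.I * (-k : ℤ) * θ) • v k‖ ^ 2 =
      2 * π * ∑ k ∈ s, ‖v k‖ ^ 2 := by
  have h1 : ∀ θ : ℝ, ((‖∑ k ∈ s, Complex.exp (Complex.I * (-k : ℤ) * θ) • v k‖ ^ 2 : ℝ) : ℂ) =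
      ∑ k ∈ s, ∑ l ∈ s, Complex.exp (Complex.I * (k - l : ℤ) * θ) * inner ℂ (v k) (v l) := by
    intro θ
    rw [Complex.ofReal_pow, coe_norm_sq_eq_inner_self, sum_inner]
    refine Finset.sum_congr rfl fun k _ => ?_
    rw [inner_sum]
    refine Finset.sum_congr rfl fun l _ => ?_
    rw [inner_smul_left, inner_smul_right, ← mul_assoc, ← Complex.exp_conj, ← Complex.exp_add]
    congr 2
    simp
    ring
  apply Complex.ofReal_injective
  rw [← intervalIntegral.integral_ofReal]
  simp_rw [h1]
  rw [intervalIntegral.integral_finsetSum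
    fun k _ => (by fun_prop : Continuous _).intervalIntegrable _ _]
  rw [Complex.ofReal_mul, Complex.ofReal_sum, Finset.mul_sum]
  refine Finset.sum_congr rfl fun k hk => ?_
  rw [intervalIntegral.integral_finsetSum
    fun k _ => (by fun_prop : Continuous _).intervalIntegrable _ _]
  simp_rw [intervalIntegral.integral_mul_const, integral_exp_I_mul_int, sub_eq_zero, ite_mul,
    zero_mul]
  rw [Finset.sum_ite_eq, if_pos hk, ← coe_norm_sq_eq_inner_self, Complex.ofReal_pow]

/-- A finitely supported `H`-valued sequence as an element of `ℓ²(ℤ; H)`. -/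
def finsuppToLp (H : Type*) [NormedAddCommGroup H] [InnerProductSpace ℂ H] :
    (ℤ →₀ H) →ₗ[ℂ] lp (fun _ : ℤ => H) 2 :=
  Finsupp.lsum ℂ fun k => lp.lsingle (𝕜 := ℂ) (E := fun _ : ℤ => H) 2 k

/-- The Fourier transform `∑ₖ e^{-ikθ} f k` of a finitely supported sequence. -/
def finsuppFourier (H : Type*) [NormedAddCommGroup H] [InnerProductSpace ℂ H] (θ : ℝ) :
    (ℤ →₀ H) →ₗ[ℂ] H :=
  Finsupp.lsum ℂ fun k => Complex.exp (Complex.I * (-k : ℤ) * θ) • LinearMap.id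

theorem finsuppToLp_single (k : ℤ) (v : H) :
    finsuppToLp H (Finsupp.single k v) = lp.single 2 k v :=
  (Finsupp.lsum_single ..).trans rfl

theorem finsuppFourier_single (θ : ℝ) (k : ℤ) (v : H) :
    finsuppFourier H θ (Finsupp.single k v) = Complex.exp (Complex.I * (-k : ℤ) * θ) • v := by
  simp [finsuppFourier]

theorem finsuppFourier_apply (θ : ℝ) (w : ℤ →₀ H) :
    finsuppFourier H θ w = ∑ k ∈ w.support, Complex.exp (Complex.I * (-k : ℤ) * θ) • w k := rfl

theorem continuous_finsuppFourier (w : ℤ →₀ H) : Continuous fun θ => finsuppFourier H θ w := by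
  simp_rw [finsuppFourier_apply]
  fun_prop

theorem integral_norm_sq_finsuppFourier (w : ℤ →₀ H) :
    ∫ θ in (0 : ℝ)..2 * π, ‖finsuppFourier H θ w‖ ^ 2 = 2 * π * ‖finsuppToLp H w‖ ^ 2 := by
  simp_rw [finsuppFourier_apply, integral_norm_sq_sum_exp_smul]
  have h := lp.norm_sum_single (E := fun _ : ℤ => H) (p := 2) (by simp) w w.support
  congr 1
  have hw : finsuppToLp H w = ∑ k ∈ w.support, lp.single 2 k (w k) := rfl
  rw [hw]
  simpa using h.symm

theorem norm_sum_constShift_ge {B : ℤ → H →L[ℂ] H} {t : Finset ℤ} {δ : ℝ}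
    (h : ∀ (θ : ℝ) v, δ * ‖v‖ ≤ ‖(∑ j ∈ t, Complex.exp (Complex.I * j * θ) • B j) v‖)
    (f : lp (fun _ : ℤ => H) 2) : δ * ‖f‖ ≤ ‖(∑ j ∈ t, constShift j (B j)) f‖ := by
  rcases le_or_gt δ 0 with hδ | hδ
  · exact (mul_nonpos_of_nonpos_of_nonneg hδ (norm_nonneg _)).trans (norm_nonneg _)
  have hfin : ∀ w : ℤ →₀ H,
      δ * ‖finsuppToLp H w‖ ≤ ‖(∑ j ∈ t, constShift j (B j)) (finsuppToLp H w)‖ := by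
    intro w
    let w' : ℤ →₀ H := ∑ k ∈ w.support, ∑ j ∈ t, Finsupp.single (k - j) (B j (w k))
    have hw : w = ∑ k ∈ w.support, Finsupp.single k (w k) := w.sum_single.symm
    have h1 : finsuppToLp H w' = (∑ j ∈ t, constShift j (B j)) (finsuppToLp H w) := by
      conv_rhs => rw [hw]
      simp only [w', map_sum, finsuppToLp_single, sum_apply,
        constShift_single]
    have h2 : ∀ θ, finsuppFourier H θ w' =
        (∑ j ∈ t, Complex.exp (Complex.I * j * θ) • B j) (finsuppFourier H θ w) := by
      intro θ
      conv_rhs => rw [hw]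
      simp only [w', map_sum, finsuppFourier_single, sum_apply,
        smul_apply, map_smul, Finset.smul_sum, smul_smul]
      refine Finset.sum_congr rfl fun k _ => Finset.sum_congr rfl fun j _ => ?_
      rw [← Complex.exp_add]
      congr 2
      push_cast
      ring
    rw [← h1, ← pow_le_pow_iff_left₀ (by positivity) (norm_nonneg _) two_ne_zero, mul_pow,
      ← mul_le_mul_iff_right₀ two_pi_pos, ← integral_norm_sq_finsuppFourier, mul_left_comm,
      ← integral_norm_sq_finsuppFourier, ← intervalIntegral.integral_const_mul]
    refine intervalIntegral.integral_mono_on two_pi_pos.le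
      (((continuous_finsuppFourier w).norm.pow 2).const_mul _ |>.intervalIntegrable _ _)
      (((continuous_finsuppFourier w').norm.pow 2).intervalIntegrable _ _) fun θ _ => ?_
    rw [h2, ← mul_pow]
    gcongr
    exact h θ _
  have hlim := lp.hasSum_single (E := fun _ : ℤ => H) (p := 2) (by simp) f
  refine le_of_tendsto_of_tendsto (hlim.norm.const_mul δ)
    (((∑ j ∈ t, constShift j (B j)).continuous.tendsto f).comp hlim).norm
    (Filter.Eventually.of_forall fun s => ?_)
  have h3 := hfin (∑ k ∈ s, Finsupp.single k (f k))
  simp only [map_sum (finsuppToLp H), finsuppToLp_single] at h3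
  exact h3

end Fourier

section PlaneWave

variable {H : Type*} [NormedAddCommGroup H] [InnerProductSpace ℂ H]

/-- The truncated plane wave `∑_{0 ≤ k < N} e^{ikθ} δₖ ⊗ v`. -/
def planeWave (N : ℕ) (θ : ℝ) (v : H) : lp (fun _ : ℤ => H) 2 :=
  ∑ k ∈ Finset.range N, Complex.exp (Complex.I * (k : ℤ) * θ) • lp.single 2 (k : ℤ) v

theorem norm_planeWave (N : ℕ) (θ : ℝ) (v : H) : ‖planeWave N θ v‖ = √N * ‖v‖ := by
  have h := lp.norm_sum_single (E := fun _ : ℤ => H) (p := 2) (by simp)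
    (fun k => Complex.exp (Complex.I * k * θ) • v) ((Finset.range N).map Nat.castEmbedding)
  simp only [Finset.sum_map, Nat.castEmbedding_apply, lp.single_smul, norm_smul,
    norm_exp_I_mul_int_mul, one_mul, ENNReal.toReal_ofNat, Real.rpow_ofNat, Finset.sum_const,
    Finset.card_map, Finset.card_range, nsmul_eq_mul] at h
  rw [← sq_eq_sq₀ (norm_nonneg _) (by positivity), mul_pow, Real.sq_sqrt (by positivity), ← h]
  rfl

theorem constShift_planeWave (j : ℤ) (B : H →L[ℂ] H) (N : ℕ) (θ : ℝ) (v : H) :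
    constShift j B (planeWave N θ v) = constShift j 1 (planeWave N θ (B v)) := by
  simp [planeWave, map_sum, constShift_single]

theorem norm_constShift_one_le (j : ℤ) (f : lp (fun _ : ℤ => H) 2) :
    ‖constShift j 1 f‖ ≤ ‖f‖ := by
  have h : ‖constShift j (1 : H →L[ℂ] H)‖ ≤ 1 :=
    (norm_constShift_le j 1).trans ContinuousLinearMap.norm_id_le
  exact ((constShift j (1 : H →L[ℂ] H)).le_of_opNorm_le h f).trans_eq (one_mul _)

theorem constShift_one_add (i j : ℤ) (f : lp (fun _ : ℤ => H) 2) :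
    constShift (i + j) 1 f = constShift i 1 (constShift j 1 f) := by
  ext k
  simp [add_assoc]

theorem norm_constShift_one_planeWave_sub_le (N : ℕ) (θ : ℝ) (v : H) :
    ‖constShift 1 1 (planeWave N θ v) - Complex.exp (Complex.I * (1 : ℤ) * θ) • planeWave N θ v‖
      ≤ 2 * ‖v‖ := by
  let g : ℕ → lp (fun _ : ℤ => H) 2 := fun k =>
    Complex.exp (Complex.I * (k : ℤ) * θ) • lp.single 2 ((k : ℤ) - 1) v
  have hg : ∀ k, ‖g k‖ = ‖v‖ := fun k => by
    rw [norm_smul, norm_exp_I_mul_int_mul, one_mul, lp.norm_single two_pos]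
  have h : constShift 1 1 (planeWave N θ v) -
      Complex.exp (Complex.I * (1 : ℤ) * θ) • planeWave N θ v = g 0 - g N := by
    rw [← Finset.sum_range_sub', planeWave, map_sum, Finset.smul_sum, ← Finset.sum_sub_distrib]
    refine Finset.sum_congr rfl fun k _ => ?_
    rw [map_smul, constShift_single, smul_smul, ← Complex.exp_add]
    simp only [g, Nat.cast_add, Nat.cast_one, add_sub_cancel_right]
    congr 4
    push_cast
    ring
  rw [h]
  linarith [norm_sub_le (g 0) (g N), hg 0, hg N]

theorem norm_constShift_natCast_planeWave_sub_le (n N : ℕ) (θ : ℝ) (v : H) :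
    ‖constShift n 1 (planeWave N θ v) - Complex.exp (Complex.I * (n : ℤ) * θ) • planeWave N θ v‖
      ≤ 2 * n * ‖v‖ := by
  induction n with
  | zero =>
    have : constShift ((0 : ℕ) : ℤ) 1 (planeWave N θ v) = planeWave N θ v := by
      rw [Nat.cast_zero, constShift_zero_one]; rfl
    rw [this]
    simp
  | succ n ih =>
    have h : constShift (n + 1 : ℕ) 1 (planeWave N θ v) -
        Complex.exp (Complex.I * (n + 1 : ℕ) * θ) • planeWave N θ v =
        constShift 1 1 (constShift n 1 (planeWave N θ v) -
          Complex.exp (Complex.I * (n : ℤ) * θ) • planeWave N θ v) +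
        Complex.exp (Complex.I * (n : ℤ) * θ) • (constShift 1 1 (planeWave N θ v) -
          Complex.exp (Complex.I * (1 : ℤ) * θ) • planeWave N θ v) := by
      rw [map_sub, ← constShift_one_add, map_smul, smul_sub, smul_smul, ← Complex.exp_add,
        sub_add_sub_cancel, show ((n + 1 : ℕ) : ℤ) = 1 + n by push_cast; ring]
      congr 3
      push_cast
      ring
    push_cast at h ⊢
    rw [h]
    refine (norm_add_le _ _).trans ?_
    have h1 := (norm_constShift_one_le 1 _).trans ih
    have h2 := norm_constShift_one_planeWave_sub_le N θ v
    have h3 := norm_exp_I_mul_int_mul n θ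
    push_cast at h1 h2 h3
    rw [norm_smul, h3, one_mul]
    linarith

theorem norm_constShift_planeWave_sub_le (j : ℤ) (N : ℕ) (θ : ℝ) (v : H) :
    ‖constShift j 1 (planeWave N θ v) - Complex.exp (Complex.I * j * θ) • planeWave N θ v‖
      ≤ 2 * j.natAbs * ‖v‖ := by
  rcases Int.eq_nat_or_neg j with ⟨n, rfl | rfl⟩
  · simpa using norm_constShift_natCast_planeWave_sub_le n N θ v
  · have h1 := norm_constShift_natCast_planeWave_sub_le n N θ v
    have h : constShift (-n : ℤ) 1 (planeWave N θ v) -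
        Complex.exp (Complex.I * (-n : ℤ) * θ) • planeWave N θ v =
        -(Complex.exp (Complex.I * (-n : ℤ) * θ) • constShift (-n : ℤ) 1
          (constShift n 1 (planeWave N θ v) -
            Complex.exp (Complex.I * (n : ℤ) * θ) • planeWave N θ v)) := by
      rw [map_sub, ← constShift_one_add, map_smul, smul_sub, smul_smul, ← Complex.exp_add,
        neg_add_cancel, constShift_zero_one]
      simp
    rw [h, norm_neg, norm_smul, norm_exp_I_mul_int_mul, one_mul]
    simpa using (norm_constShift_one_le _ _).trans h1

theorem planeWave_sum (N : ℕ) (θ : ℝ) {ι : Type*} (t : Finset ι) (v : ι → H) :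
    planeWave N θ (∑ i ∈ t, v i) = ∑ i ∈ t, planeWave N θ (v i) := by
  simp only [planeWave]
  rw [Finset.sum_comm]
  refine Finset.sum_congr rfl fun k _ => ?_
  rw [← Finset.smul_sum]
  congr 1
  exact map_sum (lp.singleAddMonoidHom (E := fun _ : ℤ => H) 2 (k : ℤ)) v t

theorem planeWave_smul (N : ℕ) (θ : ℝ) (c : ℂ) (v : H) :
    planeWave N θ (c • v) = c • planeWave N θ v := by
  simp only [planeWave, Finset.smul_sum, lp.single_smul, smul_comm c]

theorem norm_sum_exp_smul_ge {B : ℤ → H →L[ℂ] H} {t : Finset ℤ} {δ : ℝ}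
    (h : ∀ f, δ * ‖f‖ ≤ ‖(∑ j ∈ t, constShift j (B j)) f‖) (θ : ℝ) (v : H) :
    δ * ‖v‖ ≤ ‖(∑ j ∈ t, Complex.exp (Complex.I * j * θ) • B j) v‖ := by
  set S := ∑ j ∈ t, Complex.exp (Complex.I * j * θ) • B j
  set C : ℝ := ∑ j ∈ t, 2 * j.natAbs * ‖B j v‖
  have hN : ∀ N : ℕ, √N * (δ * ‖v‖ - ‖S v‖) ≤ C := by
    intro N
    have h1 : (∑ j ∈ t, constShift j (B j)) (planeWave N θ v) - planeWave N θ (S v) =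
        ∑ j ∈ t, (constShift j 1 (planeWave N θ (B j v)) -
          Complex.exp (Complex.I * j * θ) • planeWave N θ (B j v)) := by
      simp only [S, sum_apply, smul_apply, planeWave_sum, planeWave_smul,
        Finset.sum_sub_distrib, constShift_planeWave _ (B _)]
    have h2 : ‖(∑ j ∈ t, constShift j (B j)) (planeWave N θ v) - planeWave N θ (S v)‖ ≤ C := by
      rw [h1]
      exact norm_sum_le_of_le _ fun j _ => norm_constShift_planeWave_sub_le j N θ (B j v)
    have h3 := h (planeWave N θ v)
    have h4 := norm_sub_norm_le ((∑ j ∈ t, constShift j (B j)) (planeWave N θ v))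
      (planeWave N θ (S v))
    rw [norm_planeWave] at h3 h4
    linarith
  by_contra! hlt
  have hlim : Filter.Tendsto (fun N : ℕ => √N * (δ * ‖v‖ - ‖S v‖)) Filter.atTop Filter.atTop :=
    (Real.tendsto_sqrt_atTop.comp tendsto_natCast_atTop_atTop).atTop_mul_const (by linarith)
  obtain ⟨N, hlarge⟩ := (hlim.eventually_gt_atTop C).exists
  exact (hN N).not_gt hlarge

theorem norm_ge_sub_of_norm_sub_le {E : Type*} [NormedAddCommGroup E] [NormedSpace ℂ E]
    {S T : E →L[ℂ] E} {δ ε : ℝ} (hST : ‖S - T‖ ≤ ε) (hS : ∀ v, δ * ‖v‖ ≤ ‖S v‖) (v : E) :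
    (δ - ε) * ‖v‖ ≤ ‖T v‖ := by
  have h1 := (S - T).le_of_opNorm_le hST v
  rw [sub_apply] at h1
  linarith [hS v, norm_sub_norm_le (S v) (T v)]

theorem norm_ge_sub_of_norm_sub_le' {E : Type*} [NormedAddCommGroup E] [NormedSpace ℂ E]
    {S T : E →L[ℂ] E} {δ ε : ℝ} (hST : ‖T - S‖ ≤ ε) (hS : ∀ v, δ * ‖v‖ ≤ ‖S v‖) (v : E) :
    (δ - ε) * ‖v‖ ≤ ‖T v‖ :=
  norm_ge_sub_of_norm_sub_le ((norm_sub_rev S T).trans_le hST) hS v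

variable [CompleteSpace H]

theorem forall_norm_laurentOp_ge_iff {B : ℤ → H →L[ℂ] H} (hB : Summable fun j => ‖B j‖) {δ : ℝ} :
    (∀ f, δ * ‖f‖ ≤ ‖laurentOp B f‖) ↔ ∀ θ v, δ * ‖v‖ ≤ ‖laurentSymbol B θ v‖ := by
  have hlim : ∀ {x y : ℝ}, (∀ ε > 0, (δ - ε - ε) * x ≤ y) → δ * x ≤ y := by
    intro x y h
    have h1 : Filter.Tendsto (fun ε : ℝ => (δ - ε - ε) * x) (nhdsWithin 0 (Ioi 0))
        (nhds ((δ - 0 - 0) * x)) :=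
      (Continuous.tendsto (by fun_prop) 0).mono_left nhdsWithin_le_nhds
    simpa using le_of_tendsto h1 (eventually_mem_nhdsWithin.mono h)
  constructor
  · intro h θ v
    refine hlim fun ε hε => ?_
    obtain ⟨t, ht1, ht2⟩ := exists_finset_norm_sub_le hB hε
    have h1 : ∀ f, (δ - ε) * ‖f‖ ≤ ‖(∑ j ∈ t, constShift j (B j)) f‖ :=
      norm_ge_sub_of_norm_sub_le ht1 h
    exact norm_ge_sub_of_norm_sub_le' (ht2 θ) (norm_sum_exp_smul_ge h1 θ) v
  · intro h f
    refine hlim fun ε hε => ?_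
    obtain ⟨t, ht1, ht2⟩ := exists_finset_norm_sub_le hB hε
    have h1 : ∀ f, (δ - ε) * ‖f‖ ≤ ‖(∑ j ∈ t, constShift j (B j)) f‖ :=
      norm_sum_constShift_ge fun θ => norm_ge_sub_of_norm_sub_le (ht2 θ) (h θ)
    exact norm_ge_sub_of_norm_sub_le' ht1 h1 f

theorem isUnit_laurentOp_iff {B : ℤ → H →L[ℂ] H} (hB : Summable fun j => ‖B j‖) :
    IsUnit (laurentOp B) ↔ ∀ θ ∈ Ico (0 : ℝ) (2 * π), IsUnit (laurentSymbol B θ) := by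
  have hB' := summable_norm_adjoint_neg hB
  constructor
  · intro h θ _
    obtain ⟨δ, hδ, h1⟩ := exists_forall_norm_ge_of_isUnit h
    obtain ⟨δ', hδ', h2⟩ := exists_forall_norm_ge_of_isUnit h.star
    rw [ContinuousLinearMap.star_eq_adjoint, adjoint_laurentOp hB,
      forall_norm_laurentOp_ge_iff hB'] at h2
    rw [forall_norm_laurentOp_ge_iff hB] at h1
    refine isUnit_of_forall_norm_ge hδ hδ' (h1 θ) ?_
    rw [adjoint_laurentSymbol hB]
    exact h2 θ
  · intro h
    obtain ⟨δ, hδ, h1⟩ := exists_forall_norm_laurentSymbol_ge hB h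
    obtain ⟨δ', hδ', h2⟩ := exists_forall_norm_laurentSymbol_ge hB' fun θ hθ => by
      rw [← adjoint_laurentSymbol hB]
      exact (h θ hθ).star
    rw [← forall_norm_laurentOp_ge_iff hB] at h1
    rw [← forall_norm_laurentOp_ge_iff hB', ← adjoint_laurentOp hB] at h2
    exact isUnit_of_forall_norm_ge hδ hδ' h1 h2

theorem spectrum_laurentOp {B : ℤ → H →L[ℂ] H} (hB : Summable fun j => ‖B j‖) :
    spectrum ℂ (laurentOp B) = ⋃ θ ∈ Ico (0 : ℝ) (2 * π), spectrum ℂ (laurentSymbol B θ) := by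
  ext z
  let D : ℤ → H →L[ℂ] H := Pi.single 0 (algebraMap ℂ _ z)
  have hD0 : ∀ j ≠ 0, D j = 0 := fun j hj => Pi.single_eq_of_ne hj _
  have hD : Summable fun j => ‖D j‖ := summable_of_ne_finset_zero (s := {0}) fun j hj => by
    rw [hD0 j (by simpa using hj), norm_zero]
  have hDB : Summable fun j => ‖D j - B j‖ :=
    .of_nonneg_of_le (fun _ => norm_nonneg _) (fun _ => norm_sub_le _ _) (hD.add hB)
  have h0 : ∀ j : ℤ, constShift j (0 : H →L[ℂ] H) = 0 := fun j => by ext; simp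
  have h1 : algebraMap ℂ _ z - laurentOp B = laurentOp fun j => D j - B j := by
    have h2 : laurentOp D = algebraMap ℂ _ z := by
      rw [laurentOp, tsum_eq_single 0 fun j hj => by rw [hD0 j hj, h0]]
      ext f k
      simp [D, Algebra.algebraMap_eq_smul_one]
    rw [← h2, laurentOp, laurentOp, ← (summable_constShift hD).tsum_sub (summable_constShift hB)]
    refine tsum_congr fun j => ?_
    ext f k
    simp
  have h3 : ∀ θ, algebraMap ℂ _ z - laurentSymbol B θ = laurentSymbol (fun j => D j - B j) θ := by
    intro θ
    have h2 : laurentSymbol D θ = algebraMap ℂ _ z := by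
      rw [laurentSymbol, tsum_eq_single 0 fun j hj => by rw [hD0 j hj, smul_zero]]
      simp [D]
    rw [← h2, laurentSymbol, laurentSymbol, ← (summable_exp_smul hD θ).tsum_sub
      (summable_exp_smul hB θ)]
    simp only [laurentSymbol, smul_sub]
  simp only [mem_iUnion, exists_prop, spectrum.mem_iff, h1, h3, isUnit_laurentOp_iff hDB]
  push Not
  rfl

end PlaneWave

section Curry

theorem summable_norm_sq_row (f : l2Z2) (k : ℤ) : Summable fun m => ‖f (k, m)‖ ^ 2 :=
  (lp.summable_norm_sq f).prod_factor k

theorem norm_sq_row (f : l2Z2) (k : ℤ) :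
    ‖(⟨fun m => f (k, m), memℓp_two_of_summable (summable_norm_sq_row f k)⟩ : l2Z)‖ ^ 2 =
      ∑' m, ‖f (k, m)‖ ^ 2 :=
  lp.norm_sq_eq_tsum _

theorem summable_norm_sq_uncurry (g : lp (fun _ : ℤ => l2Z) 2) :
    Summable fun p : ℤ × ℤ => ‖g p.1 p.2‖ ^ 2 := by
  refine (summable_prod_of_nonneg fun _ => by positivity).2
    ⟨fun k => lp.summable_norm_sq (g k), ?_⟩
  simpa only [lp.norm_sq_eq_tsum (g _)] using lp.summable_norm_sq g

/-- The identification of `ℓ²(ℤ²)` with `ℓ²(ℤ; ℓ²(ℤ))`. -/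
def l2Curry : l2Z2 ≃ₗᵢ[ℂ] lp (fun _ : ℤ => l2Z) 2 where
  toFun f := ⟨fun k => ⟨fun m => f (k, m), memℓp_two_of_summable (summable_norm_sq_row f k)⟩,
    memℓp_two_of_summable (by simpa only [norm_sq_row] using (lp.summable_norm_sq f).prod)⟩
  invFun g := ⟨fun p => g p.1 p.2, memℓp_two_of_summable (summable_norm_sq_uncurry g)⟩
  map_add' _ _ := rfl
  map_smul' _ _ := rfl
  left_inv _ := rfl
  right_inv _ := rfl
  norm_map' f := by
    rw [← sq_eq_sq₀ (norm_nonneg _) (norm_nonneg _), lp.norm_sq_eq_tsum, lp.norm_sq_eq_tsum f,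
      (lp.summable_norm_sq f).tsum_prod]
    exact tsum_congr fun k => norm_sq_row f k

theorem l2Curry_apply (f : l2Z2) (k m : ℤ) : l2Curry f k m = f (k, m) := rfl

end Curry

section Magnetic

theorem norm_magneticPhase (h : ℝ) (j k : ℤ) : ‖Complex.exp (Complex.I * h * k * j)‖ = 1 := by
  rw [show Complex.I * h * k * j = ((h * k * j : ℝ) : ℂ) * Complex.I by push_cast; ring]
  exact Complex.norm_exp_ofReal_mul_I _

/-- The operator `(g m)ₘ ↦ (e^{ihmj} g (m + n))ₘ` on `ℓ²(ℤ)`. -/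
def magneticShift (h : ℝ) (j n : ℤ) : l2Z →L[ℂ] l2Z :=
  weightedShift (fun m => Complex.exp (Complex.I * h * m * j) • ContinuousLinearMap.id ℂ ℂ) 1
    (fun m => by rw [norm_smul, norm_magneticPhase, one_mul, ContinuousLinearMap.norm_id]) n

/-- The operator coefficient `∑ₙ c(j, n) e^{ihmj} g (m + n)` of the magnetic operator. -/
def magneticCoeff (h : ℝ) (c : ℤ × ℤ → ℂ) (j : ℤ) : l2Z →L[ℂ] l2Z :=
  ∑' n, c (j, n) • magneticShift h j n

theorem norm_smul_magneticShift_le (h : ℝ) (c : ℤ × ℤ → ℂ) (j n : ℤ) :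
    ‖c (j, n) • magneticShift h j n‖ ≤ ‖c (j, n)‖ := by
  rw [norm_smul]
  exact mul_le_of_le_one_right (norm_nonneg _) (norm_weightedShift_le _ _ _ _)

theorem summable_norm_magneticCoeff (h : ℝ) {c : ℤ × ℤ → ℂ} (hc : Summable fun q => ‖c q‖) :
    Summable fun j => ‖magneticCoeff h c j‖ :=
  hc.prod.of_nonneg_of_le (fun _ => norm_nonneg _) fun j =>
    tsum_of_norm_bounded (hc.prod_factor j).hasSum (norm_smul_magneticShift_le h c j)

theorem magneticCoeff_apply (h : ℝ) {c : ℤ × ℤ → ℂ} (hc : Summable fun q => ‖c q‖) (j : ℤ)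
    (g : l2Z) (m : ℤ) :
    magneticCoeff h c j g m =
      ∑' n, c (j, n) * (Complex.exp (Complex.I * h * m * j) * g (m + n)) := by
  have h1 : Summable fun n => c (j, n) • magneticShift h j n :=
    .of_norm_bounded (hc.prod_factor j) (norm_smul_magneticShift_le h c j)
  have h2 := h1.hasSum.mapL (ContinuousLinearMap.apply ℂ _ g)
  exact (h2.mapL (lp.evalCLM ℂ (fun _ : ℤ => ℂ) 2 m)).tsum_eq.symm

theorem summable_mul_of_norm_le {c u : ℤ × ℤ → ℂ} (hc : Summable fun q => ‖c q‖) {M : ℝ}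
    (hu : ∀ q, ‖u q‖ ≤ M) : Summable fun q => c q * u q :=
  .of_norm_bounded (hc.mul_right M) fun q => by
    rw [norm_mul]
    gcongr
    exact hu q

theorem laurentOp_magneticCoeff_apply (h : ℝ) {c : ℤ × ℤ → ℂ} (hc : Summable fun q => ‖c q‖)
    (f : l2Z2) (p : ℤ × ℤ) :
    laurentOp (magneticCoeff h c) (l2Curry f) p.1 p.2 =
      ∑' q : ℤ × ℤ, Complex.exp (Complex.I * h * p.2 * q.1) * c q * f (p + q) := by
  have h1 : Summable fun j => magneticCoeff h c j (l2Curry f (p.1 + j)) :=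
    .of_norm_bounded ((summable_norm_magneticCoeff h hc).mul_right ‖f‖) fun j =>
      ((magneticCoeff h c j).le_opNorm _).trans <| by
        gcongr
        rw [← l2Curry.norm_map f]
        exact lp.norm_apply_le_norm two_ne_zero _ _
  have h2 : Summable fun q : ℤ × ℤ =>
      c q * (Complex.exp (Complex.I * h * p.2 * q.1) * f (p + q)) :=
    summable_mul_of_norm_le hc (M := ‖f‖) fun q => by
      rw [norm_mul, norm_magneticPhase, one_mul]
      exact lp.norm_apply_le_norm two_ne_zero _ _
  rw [laurentOp_apply (summable_norm_magneticCoeff h hc)]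
  refine (h1.hasSum.mapL (lp.evalCLM ℂ (fun _ : ℤ => ℂ) 2 p.2)).tsum_eq.symm.trans ?_
  rw [tsum_congr fun q : ℤ × ℤ => show _ = c q * (Complex.exp (Complex.I * h * p.2 * q.1) *
    f (p + q)) by ring, h2.tsum_prod]
  exact tsum_congr fun j => magneticCoeff_apply h hc j _ _

theorem laurentSymbol_magneticCoeff_apply (h : ℝ) {c : ℤ × ℤ → ℂ} (hc : Summable fun q => ‖c q‖)
    (θ : ℝ) (g : l2Z) (m : ℤ) :
    laurentSymbol (magneticCoeff h c) θ g m = ∑' n : ℤ,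
      (∑' k : ℤ, c (k, n) * Complex.exp (Complex.I * k * ((m : ℝ) * h + θ))) * g (m + n) := by
  have hB := summable_norm_magneticCoeff h hc
  have h1 := ((summable_exp_smul hB θ).hasSum.mapL (ContinuousLinearMap.apply ℂ _ g)).mapL
    (lp.evalCLM ℂ (fun _ : ℤ => ℂ) 2 m)
  have hphase : ∀ k : ℤ, Complex.exp (Complex.I * k * ((m : ℝ) * h + θ)) =
      Complex.exp (Complex.I * k * θ) * Complex.exp (Complex.I * h * m * k) := fun k => by
    rw [← Complex.exp_add]
    congr 1
    push_cast
    ring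
  have h2 : Summable fun q : ℤ × ℤ =>
      c q * (Complex.exp (Complex.I * q.1 * ((m : ℝ) * h + θ)) * g (m + q.2)) :=
    summable_mul_of_norm_le hc (M := ‖g‖) fun q => by
      rw [hphase, norm_mul, norm_mul, norm_magneticPhase, norm_exp_I_mul_int_mul, one_mul, one_mul]
      exact lp.norm_apply_le_norm two_ne_zero _ _
  refine h1.tsum_eq.symm.trans ?_
  calc _ = ∑' (k : ℤ) (n : ℤ),
        c (k, n) * (Complex.exp (Complex.I * k * ((m : ℝ) * h + θ)) * g (m + n)) := by
        refine tsum_congr fun k => ?_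
        change Complex.exp (Complex.I * k * θ) * magneticCoeff h c k g m = _
        rw [magneticCoeff_apply h hc, ← tsum_mul_left]
        refine tsum_congr fun n => ?_
        rw [hphase]
        ring
    _ = ∑' (n : ℤ) (k : ℤ),
        c (k, n) * (Complex.exp (Complex.I * k * ((m : ℝ) * h + θ)) * g (m + n)) :=
        h2.tsum_comm.symm
    _ = _ := by
        refine tsum_congr fun n => ?_
        rw [← tsum_mul_right]
        exact tsum_congr fun k => (mul_assoc _ _ _).symm

theorem summable_exp_neg_mul_abs_int {β : ℝ} (hβ : 0 < β) :
    Summable fun k : ℤ => Real.exp (-β * |(k : ℝ)|) := by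
  have h := Real.summable_exp_nat_mul_iff.2 (neg_lt_zero.2 hβ)
  refine .of_nat_of_neg ?_ ?_ <;> simpa [mul_comm] using h

theorem summable_norm_of_exp_decay {a b : ℝ} (ha : 0 < a) (hb : 0 < b) {c : ℤ × ℤ → ℂ}
    (hdec : ∀ q : ℤ × ℤ,
      ‖c q‖ ≤ a * Real.exp (-b * Real.sqrt ((q.1 : ℝ) ^ 2 + (q.2 : ℝ) ^ 2))) :
    Summable fun q => ‖c q‖ := by
  have h1 := summable_exp_neg_mul_abs_int (half_pos hb)
  refine ((h1.mul_of_nonneg h1 (fun _ => (Real.exp_pos _).le)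
    fun _ => (Real.exp_pos _).le).mul_left a).of_nonneg_of_le (fun _ => norm_nonneg _)
    fun q => (hdec q).trans ?_
  rw [← Real.exp_add]
  gcongr
  have h2 : |(q.1 : ℝ)| ≤ √((q.1 : ℝ) ^ 2 + (q.2 : ℝ) ^ 2) :=
    Real.abs_le_sqrt (le_add_of_nonneg_right (sq_nonneg _))
  have h3 : |(q.2 : ℝ)| ≤ √((q.1 : ℝ) ^ 2 + (q.2 : ℝ) ^ 2) :=
    Real.abs_le_sqrt (le_add_of_nonneg_left (sq_nonneg _))
  nlinarith

end Magnetic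

end

/-- Floquet–Bloch reduction: let `C_h` be the bounded operator on `ℓ²(ℤ²)` given by
`(C_h f)(p) = Σ_q e^{ih p₂ q₁} c(q) f(p+q)` with exponentially decaying `c`, and let
`C_h(θ)` be its fibers on `ℓ²(ℤ)`, `(C_h(θ)g)(m) = Σ_n b_n(mh+θ) g(m+n)` with
`b_n(φ) = Σ_k c(k,n) e^{ikφ}`.  Then `spec C_h = ⋃_{θ∈[0,2π)} spec C_h(θ)`. -/
theorem spectrum_eq_iUnion_fiber_spectra
    (h a b : ℝ) (hh : 0 < h) (ha : 0 < a) (hb : 0 < b)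
    (c : ℤ × ℤ → ℂ)
    (hdec : ∀ q : ℤ × ℤ, ‖c q‖ ≤ a * Real.exp (-b * Real.sqrt ((q.1 : ℝ) ^ 2 + (q.2 : ℝ) ^ 2)))
    (Ch : l2Z2 →L[ℂ] l2Z2)
    (hCh : ∀ f : l2Z2, ∀ p : ℤ × ℤ,
      Ch f p = ∑' q : ℤ × ℤ, Complex.exp (Complex.I * h * p.2 * q.1) * c q * f (p + q))
    (Cfib : ℝ → (l2Z →L[ℂ] l2Z))
    (hCfib : ∀ θ : ℝ, ∀ g : l2Z, ∀ m : ℤ,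
      Cfib θ g m = ∑' n : ℤ,
        (∑' k : ℤ, c (k, n) * Complex.exp (Complex.I * k * ((m : ℝ) * h + θ))) * g (m + n)) :
    spectrum ℂ Ch = ⋃ θ ∈ Ico (0 : ℝ) (2 * π), spectrum ℂ (Cfib θ) := by
  have hc := summable_norm_of_exp_decay ha hb hdec
  have h1 : l2Curry.toContinuousLinearEquiv.conjContinuousAlgEquiv Ch =
      laurentOp (magneticCoeff h c) := by
    refine ContinuousLinearMap.ext fun g => ?_
    obtain ⟨f, rfl⟩ := l2Curry.surjective g
    rw [ContinuousLinearEquiv.conjContinuousAlgEquiv_apply_apply]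
    refine lp.ext (funext fun k => lp.ext (funext fun m => ?_))
    rw [laurentOp_magneticCoeff_apply h hc f (k, m), ← hCh f (k, m)]
    change l2Curry (Ch (l2Curry.symm (l2Curry f))) k m = _
    rw [l2Curry.symm_apply_apply, l2Curry_apply]
  have h2 : ∀ θ, Cfib θ = laurentSymbol (magneticCoeff h c) θ := fun θ => by
    ext g m
    rw [hCfib, laurentSymbol_magneticCoeff_apply h hc]
  simp only [h2]
  rw [← spectrum_laurentOp (summable_norm_magneticCoeff h hc), ← h1]
  exact (AlgEquiv.spectrum_eq l2Curry.toContinuousLinearEquiv.conjContinuousAlgEquiv Ch).symm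
end
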